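/- arXiv:2201.10955 — 2 statements merged into one kernel-verified Lean document; each statement's English description precedes it below -/
import Mathlib

section
/- Let p be an odd prime and Δ an integer with p ∤ Δ. Then for every integer n, |SL₂(ℤ/pℤ)|⁻¹ · Σ_{γ = (a, b; c, d) ∈ SL₂(ℤ/pℤ)} c_p(a + Δ·d − n) = (1 + p·χ_p(n² − 4Δ)) / (p² − 1), where χ_p denotes the Legendre symbol modulo p. -/
/-- The Ramanujan sum `c_q(x) = Σ_{r (mod q), gcd(r,q)=1} e^{2πi r x / q}`,
viewed as a function of `x ∈ ℤ/qℤ`. -/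
noncomputable def ramanujanSum (q : ℕ) (x : ZMod q) : ℂ :=
  ∑ r ∈ (Finset.range q).filter (fun r => Nat.Coprime r q),
    Complex.exp (2 * Real.pi * Complex.I * ((r * x.val : ℕ) : ℂ) / q)

/-- The Ramanujan sum modulo a prime `p` is `p - 1` at `0` and `-1` elsewhere. -/
lemma ramanujanSum_prime (p : ℕ) [Fact p.Prime] (x : ZMod p) :
    ramanujanSum p x = (if x = 0 then (p : ℂ) else 0) - 1 := by
  have hp : p.Prime := Fact.out
  have hfilter : (Finset.range p).filter (fun r => Nat.Coprime r p) = (Finset.range p).erase 0 := by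
    ext r
    simp only [Finset.mem_filter, Finset.mem_range, Finset.mem_erase]
    constructor
    · rintro ⟨hr, hc⟩
      refine ⟨?_, hr⟩
      rintro rfl
      exact hp.one_lt.ne' (by simpa using hc)
    · rintro ⟨h0, hr⟩
      exact ⟨hr, (Nat.coprime_of_lt_prime h0 hr hp).symm⟩
  have hterm (r : ℕ) : Complex.exp (2 * Real.pi * Complex.I * ((r * x.val : ℕ) : ℂ) / p) =
      ZMod.stdAddChar ((r : ZMod p) * x) := by
    have h := ZMod.stdAddChar_coe (N := p) ((r * x.val : ℕ) : ℤ)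
    push_cast [ZMod.natCast_zmod_val] at h ⊢
    exact h.symm
  have hrange : ∑ r ∈ Finset.range p, ZMod.stdAddChar ((r : ZMod p) * x) =
      ∑ r : ZMod p, ZMod.stdAddChar (r * x) := by
    refine Finset.sum_nbij' (fun r => (r : ZMod p)) ZMod.val ?_ ?_ ?_ ?_ ?_
    · simp
    · simp [ZMod.val_lt]
    · intro r hr
      exact ZMod.val_cast_of_lt (Finset.mem_range.mp hr)
    · simp
    · simp
  have hsum := AddChar.sum_mulShift x (ZMod.isPrimitive_stdAddChar p)
  rw [ZMod.card] at hsum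
  unfold ramanujanSum
  rw [hfilter, Finset.sum_congr rfl fun r _ => hterm r, Finset.sum_erase_eq_sub, hrange, hsum]
  · simp
  · simpa using hp.pos

section FiniteField

variable {F : Type*} [Field F] [Fintype F] [DecidableEq F]

lemma card_mul_eq (t : F) :
    (∑ b : F, ∑ c : F, if b * c = t then (1 : ℂ) else 0) =
      Fintype.card F - 1 + if t = 0 then (Fintype.card F : ℂ) else 0 := by
  have hb (b : F) : (∑ c : F, if b * c = t then (1 : ℂ) else 0) =
      if b = 0 then (if t = 0 then (Fintype.card F : ℂ) else 0) else 1 := by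
    split_ifs with h h'
    · simp [h, h']
    · simp [h, Ne.symm h']
    · simp [mul_comm b, ← eq_div_iff h]
  rw [Finset.sum_congr rfl fun b _ => hb b,
    ← Finset.add_sum_erase _ _ (Finset.mem_univ (0 : F)),
    Finset.sum_congr rfl fun b hb => if_neg (Finset.ne_of_mem_erase hb)]
  simp [Finset.card_erase_of_mem, Nat.cast_sub Fintype.card_pos, add_comm]

/-- Summing a function of the diagonal entries over `SL₂` of a finite field. -/
lemma sum_specialLinearGroup_diag (f : F → F → ℂ) :
    ∑ γ : Matrix.SpecialLinearGroup (Fin 2) F, f (γ.1 0 0) (γ.1 1 1) =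
      ∑ a : F, ∑ d : F, f a d *
        (Fintype.card F - 1 + if a * d = 1 then (Fintype.card F : ℂ) else 0) := by
  have hquad : ∑ γ : Matrix.SpecialLinearGroup (Fin 2) F, f (γ.1 0 0) (γ.1 1 1) =
      ∑ x : (F × F) × F × F with x.2.1 * x.2.2 = x.1.1 * x.1.2 - 1, f x.1.1 x.1.2 := by
    refine Finset.sum_bij (fun γ _ => ((γ.1 0 0, γ.1 1 1), γ.1 0 1, γ.1 1 0)) ?_ ?_ ?_ ?_
    · intro γ _
      have := γ.2
      rw [Matrix.det_fin_two] at this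
      simp [← this]
    · intro γ _ γ' _ h
      simp only [Prod.mk.injEq] at h
      ext i j
      fin_cases i <;> fin_cases j <;> simp [h]
    · rintro ⟨⟨a, d⟩, b, c⟩ h
      refine ⟨⟨!![a, b; c, d], ?_⟩, Finset.mem_univ _, by simp⟩
      rw [Matrix.det_fin_two_of]
      simp only [Finset.mem_filter, Finset.mem_univ, true_and] at h
      rw [h]; ring
    · simp
  rw [hquad, Finset.sum_filter]
  simp only [Fintype.sum_prod_type]
  refine Finset.sum_congr rfl fun a _ => Finset.sum_congr rfl fun d _ => ?_
  have h := card_mul_eq (a * d - 1)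
  simp only [sub_eq_zero] at h
  simp only [← h, Finset.mul_sum, mul_ite, mul_one, mul_zero]

lemma sum_mul_eq_one :
    (∑ a : F, ∑ d : F, if a * d = 1 then (1 : ℂ) else 0) = Fintype.card F - 1 := by
  simpa using card_mul_eq (1 : F)

lemma card_specialLinearGroup_two :
    (Fintype.card (Matrix.SpecialLinearGroup (Fin 2) F) : ℂ) =
      Fintype.card F * ((Fintype.card F : ℂ) ^ 2 - 1) := by
  have h := sum_specialLinearGroup_diag (F := F) fun _ _ => 1
  have h1 : (∑ a : F, ∑ d : F, if a * d = 1 then (Fintype.card F : ℂ) else 0) =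
      Fintype.card F * (Fintype.card F - 1) := by
    simp only [← sum_mul_eq_one, Finset.mul_sum, mul_ite, mul_one, mul_zero]
  simp only [one_mul, Finset.sum_add_distrib, h1] at h
  simp only [Finset.sum_const, Finset.card_univ, nsmul_eq_mul, mul_one] at h
  rw [h]; ring

/-- The number of roots of `δ d² - n d + 1`, in terms of its discriminant. -/
lemma sum_quadratic_roots (hF : ringChar F ≠ 2) {δ : F} (hδ : δ ≠ 0) (n : F) :
    (∑ d : F, if (n - δ * d) * d = 1 then (1 : ℂ) else 0) =
      quadraticChar F (n ^ 2 - 4 * δ) + 1 := by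
  have h2 : (2 : F) ≠ 0 := Ring.two_ne_zero hF
  have hcard : (Finset.univ.filter fun d : F => (n - δ * d) * d = 1).card =
      {x : F | x ^ 2 = n ^ 2 - 4 * δ}.toFinset.card := by
    refine Finset.card_nbij' (fun d => 2 * δ * d - n) (fun x => (x + n) / (2 * δ)) ?_ ?_ ?_ ?_
    · intro d hd
      simp only [Finset.coe_filter, Finset.mem_univ, true_and, Set.mem_ofPred_eq,
        Set.coe_toFinset] at hd ⊢
      linear_combination (-4 * δ) * hd
    · intro x hx
      simp only [Finset.coe_filter, Finset.mem_univ, true_and, Set.mem_ofPred_eq,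
        Set.coe_toFinset] at hx ⊢
      field_simp
      linear_combination -hx
    · intro d _
      field_simp
      ring
    · intro x _
      field_simp
      ring
  rw [Finset.sum_boole, hcard]
  exact_mod_cast quadraticChar_card_sqrts hF (n ^ 2 - 4 * δ)

lemma sum_specialLinearGroup_diag_eq (hF : ringChar F ≠ 2) {δ : F} (hδ : δ ≠ 0) (n : F) :
    (∑ γ : Matrix.SpecialLinearGroup (Fin 2) F,
      if γ.1 0 0 + δ * γ.1 1 1 - n = 0 then (1 : ℂ) else 0) =
      Fintype.card F * (Fintype.card F + quadraticChar F (n ^ 2 - 4 * δ)) := by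
  rw [sum_specialLinearGroup_diag fun a d => if a + δ * d - n = 0 then (1 : ℂ) else 0,
    Finset.sum_comm]
  have hd (d a : F) : a + δ * d - n = 0 ↔ a = n - δ * d := by
    rw [sub_eq_zero, eq_sub_iff_add_eq]
  have hroots := sum_quadratic_roots hF hδ n
  have hscale : (∑ d : F, if (n - δ * d) * d = 1 then (Fintype.card F : ℂ) else 0) =
      Fintype.card F * (quadraticChar F (n ^ 2 - 4 * δ) + 1) := by
    simp only [← hroots, Finset.mul_sum, mul_ite, mul_one, mul_zero]
  simp only [hd, ite_mul, one_mul, zero_mul, Finset.sum_ite_eq', Finset.mem_univ, if_true,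
    Finset.sum_add_distrib, hscale]
  simp only [Finset.sum_const, Finset.card_univ, nsmul_eq_mul]
  ring

end FiniteField

/-- Evaluation of the local singular series at an odd prime `p ∤ Δ`:
`|SL₂(ℤ/pℤ)|⁻¹ Σ_{(a,b;c,d)} c_p(a + Δd − n) = (1 + p·(n²−4Δ | p)) / (p² − 1)`,
where `(· | p)` is the Legendre symbol. -/
theorem singSeries_prime_delta_ne_zero (p : ℕ) [Fact p.Prime] (hodd : Odd p) (Δ : ℤ)
    (hΔ : ¬ (p : ℤ) ∣ Δ) (n : ℤ) :
    (Fintype.card (Matrix.SpecialLinearGroup (Fin 2) (ZMod p)) : ℂ)⁻¹ *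
      (∑ γ : Matrix.SpecialLinearGroup (Fin 2) (ZMod p),
        ramanujanSum p (γ.1 0 0 + (Δ : ZMod p) * γ.1 1 1 - (n : ZMod p))) =
    (1 + (p : ℂ) * (legendreSym p (n ^ 2 - 4 * Δ) : ℂ)) / ((p : ℂ) ^ 2 - 1) := by
  have hp : p.Prime := Fact.out
  have hF : ringChar (ZMod p) ≠ 2 := by
    rw [ZMod.ringChar_zmod_n]
    rintro rfl
    exact absurd hodd (by decide)
  have hδ : (Δ : ZMod p) ≠ 0 := by rwa [Ne, ZMod.intCast_zmod_eq_zero_iff_dvd]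
  have hcard := card_specialLinearGroup_two (F := ZMod p)
  have hcount := sum_specialLinearGroup_diag_eq hF hδ (n : ZMod p)
  rw [ZMod.card] at hcard hcount
  have hp0 : (p : ℂ) ≠ 0 := by exact_mod_cast hp.ne_zero
  have hp1 : (p : ℂ) ^ 2 - 1 ≠ 0 := by
    rw [sub_ne_zero]
    exact_mod_cast (Nat.one_lt_pow two_ne_zero hp.one_lt).ne'
  have hsum : (∑ γ : Matrix.SpecialLinearGroup (Fin 2) (ZMod p),
      ramanujanSum p (γ.1 0 0 + (Δ : ZMod p) * γ.1 1 1 - (n : ZMod p))) =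
      p * (p * (p + quadraticChar (ZMod p) ((n : ZMod p) ^ 2 - 4 * Δ))) -
        p * ((p : ℂ) ^ 2 - 1) := by
    rw [← hcount, ← hcard]
    simp only [ramanujanSum_prime, Finset.sum_sub_distrib, Finset.mul_sum, mul_ite, mul_one,
      mul_zero, Finset.sum_const, Finset.card_univ, nsmul_eq_mul]
  rw [hsum, hcard]
  simp only [legendreSym, Int.cast_sub, Int.cast_pow, Int.cast_mul, Int.cast_ofNat]
  field_simp
  ring
end

section
/- Let A, B, C, D be integers with gcd(A, B, C, D) = 1 and Δ := A·D − B·C = 0. Then: (i) for every ε > 0 there is a constant C = C(ε, A, B, C, D) such that for all integers n ≠ 0 and all Q ≥ 1, Σ_{q ≥ Q} |𝔖_q(n)| ≤ C·|n|^ε / Q (in particular the series 𝔖(n) := Σ_{q ≥ 1} 𝔖_q(n) converges absolutely); and (ii) there exist constants c₀, C₀ > 0 (depending only on A, B, C, D) such that for all integers n with |n| ≥ 3, c₀ / log log |n| ≤ 𝔖(n) ≤ C₀. -/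
/-- The linear form `ℒ(γ) = A·a + B·b + C·c + D·d` on `SL₂(ℤ/qℤ)`. -/
def Lform (A B C D : ℤ) {q : ℕ} (γ : Matrix.SpecialLinearGroup (Fin 2) (ZMod q)) : ZMod q :=
  (A : ZMod q) * γ.1 0 0 + (B : ZMod q) * γ.1 0 1 +
    (C : ZMod q) * γ.1 1 0 + (D : ZMod q) * γ.1 1 1

/-- The singular series term `𝔖_q(n) = |SL₂(ℤ/qℤ)|⁻¹ Σ_{γ ∈ SL₂(ℤ/qℤ)} c_q(ℒ(γ) − n)`
(a real number), with junk value `0` at `q = 0`. -/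
noncomputable def singSeriesTerm (A B C D : ℤ) (q : ℕ) (n : ℤ) : ℝ :=
  if h : q = 0 then 0 else
    haveI : NeZero q := ⟨h⟩
    ((Fintype.card (Matrix.SpecialLinearGroup (Fin 2) (ZMod q)) : ℂ)⁻¹ *
      ∑ γ : Matrix.SpecialLinearGroup (Fin 2) (ZMod q),
        ramanujanSum q (Lform A B C D γ - (n : ZMod q))).re

open ArithmeticFunction in
/-- The arithmetic function `d ↦ d · 1_{d ∣ k}`. -/
def dvdId (k : ℤ) : ArithmeticFunction ℤ :=
  ⟨fun d => if (d : ℤ) ∣ k then (d : ℤ) else 0, by simp⟩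

theorem dvdId_apply (k : ℤ) (d : ℕ) : dvdId k d = if (d : ℤ) ∣ k then (d : ℤ) else 0 := rfl

theorem sum_range_natCast_zmod {q : ℕ} [NeZero q] (g : ZMod q → ℂ) :
    ∑ a ∈ Finset.range q, g (a : ZMod q) = ∑ x, g x := by
  refine Finset.sum_bij' (fun a _ => (a : ZMod q)) (fun x _ => x.val) ?_ ?_ ?_ ?_ ?_
  · simp
  · intro x _
    simpa using x.val_lt
  · intro a ha
    exact ZMod.val_cast_of_lt (Finset.mem_range.1 ha)
  · simp
  · simp

theorem sum_range_filter_dvd {q d : ℕ} (hq : 0 < q) (hd : d ∣ q) (F : ℕ → ℂ) :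
    ∑ a ∈ (Finset.range q).filter (d ∣ ·), F a = ∑ b ∈ Finset.range (q / d), F (d * b) := by
  have hd0 : 0 < d := Nat.pos_of_dvd_of_pos hd hq
  symm
  refine Finset.sum_bij (fun b _ => d * b) ?_ ?_ ?_ ?_
  · intro b hb
    have := Finset.mem_range.1 hb
    simp only [Finset.mem_filter, Finset.mem_range, dvd_mul_right, and_true]
    rwa [Nat.lt_div_iff_mul_lt' hd] at this
  · intro b _ c _ h
    exact Nat.eq_of_mul_eq_mul_left hd0 h
  · intro a ha
    obtain ⟨ha, b, rfl⟩ := Finset.mem_filter.1 ha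
    refine ⟨b, ?_, rfl⟩
    rw [Finset.mem_range, Nat.lt_div_iff_mul_lt' hd]
    exact Finset.mem_range.1 ha
  · simp

theorem sum_range_stdAddChar {q : ℕ} [NeZero q] (k : ℤ) :
    ∑ a ∈ Finset.range q, ZMod.stdAddChar ((a : ZMod q) * (k : ZMod q)) = (dvdId k q : ℂ) := by
  rw [sum_range_natCast_zmod (fun x => ZMod.stdAddChar (x * (k : ZMod q))),
    AddChar.sum_mulShift _ (ZMod.isPrimitive_stdAddChar q), dvdId_apply,
    ZMod.card]
  simp only [ZMod.intCast_zmod_eq_zero_iff_dvd]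
  split_ifs <;> simp

theorem sum_range_filter_dvd_stdAddChar {q d : ℕ} [NeZero q] (hd : d ∣ q) (k : ℤ) :
    ∑ a ∈ (Finset.range q).filter (d ∣ ·), ZMod.stdAddChar ((a : ZMod q) * (k : ZMod q)) =
      (dvdId k (q / d) : ℂ) := by
  have hq : 0 < q := Nat.pos_of_neZero q
  rw [sum_range_filter_dvd hq hd (fun a => ZMod.stdAddChar ((a : ZMod q) * (k : ZMod q)))]
  obtain ⟨e, rfl⟩ := hd
  have hd0 : 0 < d := Nat.pos_of_mul_pos_right hq
  have he0 : 0 < e := Nat.pos_of_mul_pos_left hq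
  have : NeZero e := ⟨he0.ne'⟩
  rw [Nat.mul_div_cancel_left e hd0, ← sum_range_stdAddChar]
  refine Finset.sum_congr rfl fun b _ => ?_
  have h1 := ZMod.stdAddChar_coe (N := d * e) ((d * b : ℕ) * k)
  have h2 := ZMod.stdAddChar_coe (N := e) (b * k)
  push_cast at h1 h2 ⊢
  rw [h1, h2]
  congr 1
  have : (d : ℂ) ≠ 0 := by exact_mod_cast hd0.ne'
  have : (e : ℂ) ≠ 0 := by exact_mod_cast he0.ne'
  field_simp

open ArithmeticFunction in
theorem ite_coprime_eq_sum_moebius {q : ℕ} (hq : 0 < q) (a : ℕ) :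
    (if a.Coprime q then (1 : ℂ) else 0) =
      ∑ d ∈ q.divisors, if d ∣ a then (moebius d : ℂ) else 0 := by
  have h : ∑ d ∈ (a.gcd q).divisors, (moebius d : ℤ) = if a.gcd q = 1 then 1 else 0 := by
    rw [← coe_mul_zeta_apply, moebius_mul_coe_zeta, one_apply]
  have hdiv : (a.gcd q).divisors = q.divisors.filter (· ∣ a) := by
    ext d
    simp only [Nat.mem_divisors, Finset.mem_filter, Nat.dvd_gcd_iff]
    have : a.gcd q ≠ 0 := (Nat.gcd_pos_of_pos_right a hq).ne'
    have := hq.ne'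
    tauto
  rw [← Finset.sum_filter, ← hdiv, ← Int.cast_sum, h]
  simp [Nat.coprime_iff_gcd_eq_one]

open ArithmeticFunction in
theorem sum_coprime_stdAddChar {q : ℕ} [NeZero q] (k : ℤ) :
    ∑ a ∈ (Finset.range q).filter (fun a => a.Coprime q),
      ZMod.stdAddChar ((a : ZMod q) * (k : ZMod q)) = ((moebius * dvdId k) q : ℂ) := by
  have hq : 0 < q := Nat.pos_of_neZero q
  calc _ = ∑ a ∈ Finset.range q, ∑ d ∈ q.divisors,
        (moebius d : ℂ) * if d ∣ a then ZMod.stdAddChar ((a : ZMod q) * (k : ZMod q)) else 0 := by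
        rw [Finset.sum_filter]
        refine Finset.sum_congr rfl fun a _ => ?_
        rw [← one_mul (ZMod.stdAddChar _), ← ite_zero_mul, ite_coprime_eq_sum_moebius hq,
          Finset.sum_mul]
        refine Finset.sum_congr rfl fun d _ => ?_
        split_ifs <;> simp
    _ = ∑ d ∈ q.divisors, (moebius d : ℂ) * (dvdId k (q / d) : ℂ) := by
        rw [Finset.sum_comm]
        refine Finset.sum_congr rfl fun d hd => ?_
        rw [← Finset.mul_sum, ← Finset.sum_filter,
          sum_range_filter_dvd_stdAddChar (Nat.dvd_of_mem_divisors hd)]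
    _ = _ := by
        rw [mul_apply, Nat.sum_divisorsAntidiagonal (fun x y => moebius x * dvdId k y)]
        push_cast
        rfl

open ArithmeticFunction in
theorem sum_coprime_pair_stdAddChar {q : ℕ} [NeZero q] (k : ℤ) :
    ∑ a ∈ Finset.range q, ∑ c ∈ Finset.range q,
      (if (a.gcd c).Coprime q then ZMod.stdAddChar ((a : ZMod q) * (k : ZMod q)) else 0) =
      ((moebius * (dvdId 0).pmul (dvdId k)) q : ℂ) := by
  have hq : 0 < q := Nat.pos_of_neZero q
  calc _ = ∑ a ∈ Finset.range q, ∑ c ∈ Finset.range q, ∑ d ∈ q.divisors,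
        (moebius d : ℂ) * ((if d ∣ c then ZMod.stdAddChar ((c : ZMod q) * ((0 : ℤ) : ZMod q)) else 0) *
          if d ∣ a then ZMod.stdAddChar ((a : ZMod q) * (k : ZMod q)) else 0) := by
        refine Finset.sum_congr rfl fun a _ => Finset.sum_congr rfl fun c _ => ?_
        rw [← one_mul (ZMod.stdAddChar _), ← ite_zero_mul, ite_coprime_eq_sum_moebius hq,
          Finset.sum_mul]
        refine Finset.sum_congr rfl fun d _ => ?_
        simp only [Nat.dvd_gcd_iff]
        by_cases h1 : d ∣ a <;> by_cases h2 : d ∣ c <;> simp [h1, h2]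
    _ = ∑ d ∈ q.divisors, (moebius d : ℂ) * ((dvdId 0 (q / d) : ℂ) * (dvdId k (q / d) : ℂ)) := by
        rw [Finset.sum_congr rfl fun a _ => Finset.sum_comm, Finset.sum_comm]
        refine Finset.sum_congr rfl fun d hd => ?_
        simp only [← Finset.mul_sum, ← Finset.sum_mul, ← Finset.sum_filter]
        rw [sum_range_filter_dvd_stdAddChar (Nat.dvd_of_mem_divisors hd),
          sum_range_filter_dvd_stdAddChar (Nat.dvd_of_mem_divisors hd)]
    _ = _ := by
        rw [mul_apply,
          Nat.sum_divisorsAntidiagonal (fun x y => moebius x * (dvdId 0).pmul (dvdId k) y)]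
        push_cast [pmul_apply]
        rfl

theorem isCoprime_natCast_zmod_iff {q : ℕ} (a c : ℕ) :
    IsCoprime (a : ZMod q) (c : ZMod q) ↔ (a.gcd c).Coprime q := by
  rw [← ZMod.isUnit_iff_coprime]
  constructor
  · intro h
    exact h.isUnit_of_dvd' (Nat.cast_dvd_cast (Nat.gcd_dvd_left a c))
      (Nat.cast_dvd_cast (Nat.gcd_dvd_right a c))
  · intro h
    obtain ⟨v, hv⟩ := h.exists_left_inv
    have hb := congrArg (Int.cast : ℤ → ZMod q) (Nat.gcd_eq_gcd_ab a c)
    push_cast at hb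
    rw [hb] at hv
    exact ⟨v * (a.gcdA c : ZMod q), v * (a.gcdB c : ZMod q), by rw [← hv]; ring⟩

open Matrix MatrixGroups in
theorem card_SL2_fiber_col {R : Type*} [CommRing R] [Fintype R] [DecidableEq R] {a c : R}
    (h : IsCoprime a c) :
    ((Finset.univ : Finset SL(2, R)).filter (fun γ => (γ.1 0 0, γ.1 1 0) = (a, c))).card =
      Fintype.card R := by
  obtain ⟨g, hga, hgc⟩ := h.exists_SL2_col 0
  have hga' : g.1 0 0 = a := hga
  have hgc' : g.1 1 0 = c := hgc
  have hdet := g.2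
  rw [det_fin_two, hga', hgc'] at hdet
  symm
  rw [← Finset.card_univ]
  refine Finset.card_bij (fun t _ => ⟨!![a, a * t + g.1 0 1; c, c * t + g.1 1 1], by
    rw [det_fin_two_of]; linear_combination hdet⟩) ?_ ?_ ?_
  · intro t _
    exact Finset.mem_filter.2 ⟨Finset.mem_univ _, rfl⟩
  · intro t _ s _ hts
    have h0 := congrArg (fun γ : SL(2, R) => γ.1 0 1) hts
    have h1 := congrArg (fun γ : SL(2, R) => γ.1 1 1) hts
    simp only [of_apply, cons_val', cons_val_zero, cons_val_one, cons_val_fin_one] at h0 h1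
    linear_combination (g.1 1 1) * h0 - (g.1 0 1) * h1 - (t - s) * hdet
  · intro γ hγ
    simp only [Finset.mem_filter, Finset.mem_univ, true_and, Prod.mk.injEq] at hγ
    have hγd := γ.2
    rw [det_fin_two, hγ.1, hγ.2] at hγd
    refine ⟨g.1 1 1 * γ.1 0 1 - g.1 0 1 * γ.1 1 1, Finset.mem_univ _, ?_⟩
    ext i j
    fin_cases i <;> fin_cases j
    · exact hγ.1.symm
    · change a * (g.1 1 1 * γ.1 0 1 - g.1 0 1 * γ.1 1 1) + g.1 0 1 = γ.1 0 1
      linear_combination (γ.1 0 1) * hdet - (g.1 0 1) * hγd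
    · exact hγ.2.symm
    · change c * (g.1 1 1 * γ.1 0 1 - g.1 0 1 * γ.1 1 1) + g.1 1 1 = γ.1 1 1
      linear_combination (γ.1 1 1) * hdet - (g.1 1 1) * hγd

open Matrix MatrixGroups in
theorem sum_SL2_apply_zero_zero {q : ℕ} [NeZero q] (g : ZMod q → ℂ) :
    ∑ γ : SL(2, ZMod q), g (γ.1 0 0) =
      q * ∑ a ∈ Finset.range q, ∑ c ∈ Finset.range q,
        (if (a.gcd c).Coprime q then g (a : ZMod q) else 0) := by
  classical
  have hfib : ∀ x : ZMod q × ZMod q,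
      ∑ γ ∈ (Finset.univ : Finset SL(2, ZMod q)).filter (fun γ => (γ.1 0 0, γ.1 1 0) = x),
        g (γ.1 0 0) = q * if IsCoprime x.1 x.2 then g x.1 else 0 := by
    rintro ⟨a, c⟩
    split_ifs with h
    · rw [Finset.sum_congr rfl (g := fun _ => g a), Finset.sum_const, card_SL2_fiber_col h,
        ZMod.card, nsmul_eq_mul]
      intro γ hγ
      simp only [Finset.mem_filter, Finset.mem_univ, true_and, Prod.mk.injEq] at hγ
      rw [hγ.1]
    · rw [mul_zero]
      refine Finset.sum_eq_zero fun γ hγ => absurd ?_ h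
      simp only [Finset.mem_filter, Finset.mem_univ, true_and, Prod.mk.injEq] at hγ
      have hd := γ.2
      rw [det_fin_two, hγ.1, hγ.2] at hd
      exact ⟨γ.1 1 1, -γ.1 0 1, by linear_combination hd⟩
  rw [← Finset.sum_fiberwise _ (fun γ : SL(2, ZMod q) => (γ.1 0 0, γ.1 1 0))]
  simp_rw [hfib]
  rw [← Finset.mul_sum, Fintype.sum_prod_type,
    ← sum_range_natCast_zmod (fun a => ∑ c, if IsCoprime a c then g a else 0)]
  congr 1
  refine Finset.sum_congr rfl fun a _ => ?_
  rw [← sum_range_natCast_zmod (fun c => if IsCoprime (a : ZMod q) c then g a else 0)]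
  simp_rw [isCoprime_natCast_zmod_iff]

theorem exists_rank_one_factorization {A B C D : ℤ}
    (hgcd : Int.gcd A (Int.gcd B (Int.gcd C D)) = 1) (hΔ : A * D - B * C = 0) :
    ∃ u₁ u₂ v₁ v₂ : ℤ, IsCoprime u₁ u₂ ∧ IsCoprime v₁ v₂ ∧
      A = u₁ * v₁ ∧ B = u₁ * v₂ ∧ C = u₂ * v₁ ∧ D = u₂ * v₂ := by
  have hunit : ∀ d : ℤ, d ∣ A → d ∣ B → d ∣ C → d ∣ D → IsUnit d := by
    intro d hA hB hC hD
    have h := Int.dvd_coe_gcd hA (Int.dvd_coe_gcd hB (Int.dvd_coe_gcd hC hD))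
    rw [hgcd] at h
    exact isUnit_of_dvd_one (by simpa using h)
  by_cases hAB : A = 0 ∧ B = 0
  · obtain ⟨rfl, rfl⟩ := hAB
    refine ⟨0, 1, C, D, isCoprime_one_right, ?_, by simp⟩
    rw [Int.isCoprime_iff_gcd_eq_one]
    simpa using hgcd
  · have hpos : 0 < Int.gcd A B := by
      rw [Int.gcd_pos_iff]
      tauto
    obtain ⟨v₁, v₂, hv, hA, hB⟩ := Int.exists_gcd_one hpos
    have hg : ((Int.gcd A B : ℕ) : ℤ) ≠ 0 := by exact_mod_cast hpos.ne'
    generalize ((Int.gcd A B : ℕ) : ℤ) = g at hA hB hg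
    have hvc : IsCoprime v₁ v₂ := Int.isCoprime_iff_gcd_eq_one.2 hv
    obtain ⟨x, y, hxy⟩ := id hvc
    have hprop : v₁ * D = v₂ * C := by
      apply mul_left_cancel₀ hg
      rw [hA, hB] at hΔ
      linear_combination hΔ
    have hC : C = (x * C + y * D) * v₁ := by linear_combination -C * hxy - y * hprop
    have hD : D = (x * C + y * D) * v₂ := by linear_combination -D * hxy + x * hprop
    refine ⟨g, x * C + y * D, v₁, v₂, ?_, hvc, by rw [hA, mul_comm], by rw [hB, mul_comm], hC, hD⟩
    rw [← isRelPrime_iff_isCoprime]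
    intro d h1 h2
    refine hunit d ?_ ?_ ?_ ?_
    · rw [hA]; exact h1.mul_left _
    · rw [hB]; exact h1.mul_left _
    · rw [hC]; exact h2.mul_right _
    · rw [hD]; exact h2.mul_right _

open Matrix MatrixGroups in
theorem exists_Lform_eq_apply_zero_zero {A B C D : ℤ}
    (hgcd : Int.gcd A (Int.gcd B (Int.gcd C D)) = 1) (hΔ : A * D - B * C = 0) (q : ℕ) :
    ∃ P Q : SL(2, ZMod q), ∀ γ : SL(2, ZMod q), Lform A B C D γ = (P * γ * Q).1 0 0 := by
  obtain ⟨u₁, u₂, v₁, v₂, hu, hv, rfl, rfl, rfl, rfl⟩ := exists_rank_one_factorization hgcd hΔ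
  obtain ⟨P, hP0, hP1⟩ := (hu.map (Int.castRingHom (ZMod q))).exists_SL2_row 0
  obtain ⟨Q, hQ0, hQ1⟩ := (hv.map (Int.castRingHom (ZMod q))).exists_SL2_col 0
  refine ⟨P, Q, fun γ => ?_⟩
  have h0 : P.1 0 0 = (u₁ : ZMod q) := hP0
  have h1 : P.1 0 1 = (u₂ : ZMod q) := hP1
  have h2 : Q.1 0 0 = (v₁ : ZMod q) := hQ0
  have h3 : Q.1 1 0 = (v₂ : ZMod q) := hQ1
  change _ = (P.1 * γ.1 * Q.1) 0 0
  rw [Lform]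
  simp only [mul_apply, Fin.sum_univ_two, h0, h1, h2, h3]
  push_cast
  ring

theorem ramanujanSum_eq_sum_stdAddChar {q : ℕ} [NeZero q] (x : ZMod q) :
    ramanujanSum q x = ∑ r ∈ (Finset.range q).filter (fun r => r.Coprime q),
      ZMod.stdAddChar ((r : ZMod q) * x) := by
  refine Finset.sum_congr rfl fun r _ => ?_
  have h := ZMod.stdAddChar_coe (N := q) (r * x.val : ℕ)
  push_cast [ZMod.natCast_zmod_val] at h ⊢
  rw [h]

open Matrix MatrixGroups in
theorem sum_SL2_stdAddChar_mul_unit {q : ℕ} [NeZero q] (u : (ZMod q)ˣ) :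
    ∑ γ : SL(2, ZMod q), ZMod.stdAddChar ((u : ZMod q) * γ.1 0 0) =
      ∑ γ : SL(2, ZMod q), ZMod.stdAddChar (γ.1 0 0) := by
  let E : SL(2, ZMod q) := ⟨!![(u : ZMod q), 0; 0, ((u⁻¹ : (ZMod q)ˣ) : ZMod q)], by simp⟩
  rw [← Equiv.sum_comp (Equiv.mulLeft E) (fun γ => ZMod.stdAddChar (γ.1 0 0))]
  refine Finset.sum_congr rfl fun γ _ => ?_
  congr 1
  change _ = (E.1 * γ.1) 0 0
  rw [mul_apply, Fin.sum_univ_two]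
  simp [E]

open ArithmeticFunction in
theorem dvdId_zero_pmul_dvdId_one : (dvdId 0).pmul (dvdId 1) = 1 := by
  ext d
  rw [pmul_apply, dvdId_apply, dvdId_apply, one_apply]
  have : (d : ℤ) ∣ 1 ↔ d = 1 := by
    rw [show (1 : ℤ) = ((1 : ℕ) : ℤ) by simp, Int.natCast_dvd_natCast, Nat.dvd_one]
  simp only [this]
  by_cases h : d = 1 <;> simp [h]

open ArithmeticFunction Matrix MatrixGroups in
theorem card_SL2_zmod {q : ℕ} [NeZero q] :
    (Fintype.card SL(2, ZMod q) : ℂ) = q * ((moebius * (dvdId 0).pmul (dvdId 0)) q : ℂ) := by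
  have h := sum_SL2_apply_zero_zero (q := q) (fun _ => 1)
  rw [← sum_coprime_pair_stdAddChar]
  simpa using h

open ArithmeticFunction Matrix MatrixGroups in
theorem sum_SL2_stdAddChar {q : ℕ} [NeZero q] :
    ∑ γ : SL(2, ZMod q), ZMod.stdAddChar (γ.1 0 0) = q * (moebius q : ℂ) := by
  have h := sum_coprime_pair_stdAddChar (q := q) 1
  rw [dvdId_zero_pmul_dvdId_one, mul_one] at h
  rw [sum_SL2_apply_zero_zero, ← h]
  simp

theorem dvdId_neg (k : ℤ) : dvdId (-k) = dvdId k := by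
  ext d
  simp [dvdId_apply]

open ArithmeticFunction Matrix MatrixGroups in
theorem singSeriesTerm_eq {A B C D : ℤ}
    (hgcd : Int.gcd A (Int.gcd B (Int.gcd C D)) = 1) (hΔ : A * D - B * C = 0) (q : ℕ) (n : ℤ) :
    singSeriesTerm A B C D q n = (moebius q : ℝ) * ((moebius * dvdId n) q : ℝ) /
      ((moebius * (dvdId 0).pmul (dvdId 0)) q : ℝ) := by
  rcases Nat.eq_zero_or_pos q with rfl | hq
  · simp [singSeriesTerm]
  have : NeZero q := ⟨hq.ne'⟩
  have hsum : ∑ γ : SL(2, ZMod q), ramanujanSum q (Lform A B C D γ - (n : ZMod q)) =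
      ((moebius * dvdId n) q : ℂ) * (q * (moebius q : ℂ)) := by
    obtain ⟨P, Q, hPQ⟩ := exists_Lform_eq_apply_zero_zero hgcd hΔ q
    simp_rw [hPQ]
    refine (Equiv.sum_comp ((Equiv.mulLeft P).trans (Equiv.mulRight Q))
      (fun γ : SL(2, ZMod q) => ramanujanSum q (γ.1 0 0 - (n : ZMod q)))).trans ?_
    simp_rw [ramanujanSum_eq_sum_stdAddChar]
    rw [Finset.sum_comm, ← dvdId_neg, ← sum_coprime_stdAddChar, Finset.sum_mul]
    refine Finset.sum_congr rfl fun r hr => ?_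
    have hr' := (Finset.mem_filter.1 hr).2
    have hu := sum_SL2_stdAddChar_mul_unit (ZMod.unitOfCoprime r hr')
    rw [ZMod.coe_unitOfCoprime, sum_SL2_stdAddChar] at hu
    rw [← hu, Finset.mul_sum]
    refine Finset.sum_congr rfl fun γ _ => ?_
    rw [← AddChar.map_add_eq_mul]
    congr 1
    push_cast
    ring
  have hqC : (q : ℂ) ≠ 0 := by exact_mod_cast hq.ne'
  have hre : ((Fintype.card SL(2, ZMod q) : ℂ)⁻¹ * (((moebius * dvdId n) q : ℂ) *
      (q * (moebius q : ℂ)))) = (((moebius q : ℝ) * ((moebius * dvdId n) q : ℝ) /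
      ((moebius * (dvdId 0).pmul (dvdId 0)) q : ℝ) : ℝ) : ℂ) := by
    rw [card_SL2_zmod]
    push_cast
    rw [mul_inv, div_eq_mul_inv]
    field_simp
  rw [singSeriesTerm, dif_neg hq.ne', hsum, hre, Complex.ofReal_re]

open Finset Nat in
theorem sum_log_div_primesLE_le (N : ℕ) (hN : 1 ≤ N) :
    ∑ p ∈ N.primesLE, Real.log p / p ≤ Real.log N + Real.log 4 := by
  have hdvd : ∏ p ∈ N.primesLE, p ^ (N / p) ∣ N ! := by
    refine Finset.prod_dvd_of_isRelPrime ?_ ?_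
    · intro p hp r hr hpr
      have hp' := (mem_primesLE.1 hp).2
      have hr' := (mem_primesLE.1 hr).2
      exact (Nat.coprime_iff_isRelPrime).1
        (Nat.Coprime.pow _ _ ((Nat.coprime_primes hp' hr').2 hpr))
    · intro p hp
      obtain ⟨hpN, hpp⟩ := mem_primesLE.1 hp
      rw [hpp.pow_dvd_factorial_iff (Nat.lt_succ_self _)]
      refine le_trans ?_ (Finset.single_le_sum (f := fun i => N / p ^ i)
        (fun _ _ => Nat.zero_le _) (a := 1) ?_)
      · simp
      · rw [Finset.mem_Ico]
        exact ⟨le_rfl, Nat.succ_lt_succ (Nat.log_pos hpp.one_lt hpN)⟩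
  have hle : ∏ p ∈ N.primesLE, p ^ (N / p) ≤ N ^ N :=
    (Nat.le_of_dvd (Nat.factorial_pos N) hdvd).trans (Nat.factorial_le_pow N)
  have hpos : ∀ p ∈ N.primesLE, (0 : ℝ) < p := fun p hp => by
    exact_mod_cast (mem_primesLE.1 hp).2.pos
  have hN0 : (0 : ℝ) < N := by exact_mod_cast hN
  have h1 : ∑ p ∈ N.primesLE, ((N / p : ℕ) : ℝ) * Real.log p ≤ N * Real.log N := by
    have : Real.log (∏ p ∈ N.primesLE, (p : ℝ) ^ (N / p)) ≤ Real.log ((N : ℝ) ^ N) := by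
      apply Real.log_le_log (Finset.prod_pos fun p hp => pow_pos (hpos p hp) _)
      exact_mod_cast hle
    rw [Real.log_prod (fun p hp => (pow_pos (hpos p hp) _).ne')] at this
    simpa [Real.log_pow] using this
  have h2 : ∑ p ∈ N.primesLE, Real.log p ≤ Real.log 4 * N := by
    have := Chebyshev.theta_le_log4_mul_x (x := (N : ℝ)) hN0.le
    rwa [Chebyshev.theta_eq_sum_primesLE_log] at this
  have h3 : N * ∑ p ∈ N.primesLE, Real.log p / p ≤
      ∑ p ∈ N.primesLE, ((N / p : ℕ) : ℝ) * Real.log p + ∑ p ∈ N.primesLE, Real.log p := by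
    rw [Finset.mul_sum, ← Finset.sum_add_distrib]
    refine Finset.sum_le_sum fun p hp => ?_
    have hlog : 0 ≤ Real.log p := Real.log_natCast_nonneg p
    have : (N : ℝ) / p ≤ ((N / p : ℕ) : ℝ) + 1 := by
      have h := Nat.lt_div_mul_add (a := N) (mem_primesLE.1 hp).2.pos
      rw [div_le_iff₀ (hpos p hp)]
      have : (N : ℝ) < (N / p : ℕ) * p + p := by exact_mod_cast h
      linarith
    calc (N : ℝ) * (Real.log p / p) = (N / p) * Real.log p := by ring
      _ ≤ (((N / p : ℕ) : ℝ) + 1) * Real.log p := by gcongr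
      _ = _ := by ring
  refine le_of_mul_le_mul_left ?_ hN0
  linarith

open Finset in
theorem sum_Icc_rpow_neg_le {δ : ℝ} (hδ : 0 < δ) (N : ℕ) :
    ∑ m ∈ Icc 1 N, (m : ℝ) ^ (-(1 + δ)) ≤ 1 + 1 / δ := by
  have key : ∀ N : ℕ, 1 ≤ N →
      ∑ m ∈ Icc 1 N, (m : ℝ) ^ (-(1 + δ)) ≤ 1 + 1 / δ - (N : ℝ) ^ (-δ) / δ := by
    intro N hN
    induction N, hN using Nat.le_induction with
    | base => simp
    | succ k hk ih =>
      rw [Finset.sum_Icc_succ_top (by omega)]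
      have hk0 : (0 : ℝ) < k := by exact_mod_cast hk
      have hm0 : (0 : ℝ) < (k : ℝ) + 1 := by positivity
      have hlog : 1 / ((k : ℝ) + 1) ≤ Real.log (k + 1) - Real.log k := by
        have := Real.log_le_sub_one_of_pos (div_pos hk0 hm0)
        rw [Real.log_div hk0.ne' hm0.ne'] at this
        have h2 : (k : ℝ) / (k + 1) - 1 = -(1 / (k + 1)) := by field_simp; ring
        linarith
      have hexp : 1 + δ * (1 / ((k : ℝ) + 1)) ≤ (k : ℝ) ^ (-δ) / ((k : ℝ) + 1) ^ (-δ) := by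
        rw [Real.rpow_def_of_pos hk0, Real.rpow_def_of_pos hm0, ← Real.exp_sub]
        refine le_trans ?_ (Real.add_one_le_exp _)
        nlinarith
      have hm : (0 : ℝ) < ((k : ℝ) + 1) ^ (-δ) := by positivity
      rw [le_div_iff₀ hm] at hexp
      have hsplit : ((k : ℝ) + 1) ^ (-(1 + δ)) = ((k : ℝ) + 1) ^ (-δ) * (1 / (k + 1)) := by
        rw [show -(1 + δ) = -δ + -1 by ring, Real.rpow_add hm0, Real.rpow_neg_one, one_div]
      push_cast
      rw [hsplit]
      have : ((k : ℝ) + 1) ^ (-δ) * (1 / (k + 1)) ≤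
          (k : ℝ) ^ (-δ) / δ - ((k : ℝ) + 1) ^ (-δ) / δ := by
        rw [← sub_div, le_div_iff₀ hδ]
        linarith
      linarith
  rcases Nat.eq_zero_or_pos N with rfl | hN
  · simp; positivity
  · refine (key N hN).trans ?_
    have : 0 ≤ (N : ℝ) ^ (-δ) / δ := by positivity
    linarith

open Finset in
theorem prod_one_add_rpow_neg_le {δ : ℝ} (hδ : 0 < δ) (s : Finset ℕ) (hs : ∀ p ∈ s, p.Prime) :
    ∏ p ∈ s, (1 + (p : ℝ) ^ (-(1 + δ))) ≤ 1 + 1 / δ := by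
  rw [Finset.prod_one_add]
  have hinj : Set.InjOn (fun t : Finset ℕ => ∏ p ∈ t, p) s.powerset := by
    intro t ht u hu h
    have ht' := Finset.mem_powerset.1 ht
    have hu' := Finset.mem_powerset.1 hu
    rw [← Nat.primeFactors_prod (fun p hp => hs p (ht' hp)),
      ← Nat.primeFactors_prod (fun p hp => hs p (hu' hp))]
    exact congrArg Nat.primeFactors h
  calc ∑ t ∈ s.powerset, ∏ p ∈ t, (p : ℝ) ^ (-(1 + δ))
      = ∑ t ∈ s.powerset, ((∏ p ∈ t, p : ℕ) : ℝ) ^ (-(1 + δ)) := by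
        refine Finset.sum_congr rfl fun t _ => ?_
        rw [Nat.cast_prod, Real.finsetProd_rpow _ _ (fun i _ => Nat.cast_nonneg i)]
    _ = ∑ m ∈ s.powerset.image (fun t => ∏ p ∈ t, p), (m : ℝ) ^ (-(1 + δ)) :=
        (Finset.sum_image (f := fun m : ℕ => (m : ℝ) ^ (-(1 + δ))) hinj).symm
    _ ≤ ∑ m ∈ Icc 1 (∏ p ∈ s, p), (m : ℝ) ^ (-(1 + δ)) := by
        refine Finset.sum_le_sum_of_subset_of_nonneg ?_ fun _ _ _ => by positivity
        intro m hm
        obtain ⟨t, ht, rfl⟩ := Finset.mem_image.1 hm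
        have ht' := Finset.mem_powerset.1 ht
        rw [Finset.mem_Icc]
        exact ⟨Finset.prod_pos fun p hp => (hs p (ht' hp)).pos,
          Nat.le_of_dvd (Finset.prod_pos fun p hp => (hs p hp).pos)
            (Finset.prod_dvd_prod_of_subset _ _ _ ht')⟩
    _ ≤ _ := sum_Icc_rpow_neg_le hδ _

open Finset in
theorem prod_primesLE_one_add_inv_le (N : ℕ) (hN : 1 ≤ N) :
    ∏ p ∈ N.primesLE, (1 + (p : ℝ)⁻¹) ≤ Real.exp 3 * (1 + Real.log N) := by
  rcases hN.eq_or_lt with rfl | hN2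
  · have : Nat.primesLE 1 = ∅ := by decide
    rw [this]
    simp
  have hpr : ∀ p ∈ N.primesLE, p.Prime := fun p hp => (Nat.mem_primesLE.1 hp).2
  have hlog2 : 0.69 < Real.log 2 := by have := Real.log_two_gt_d9; linarith
  have hlogN : Real.log 2 ≤ Real.log N :=
    Real.log_le_log (by norm_num) (by exact_mod_cast hN2)
  have hlogN0 : 0 < Real.log N := by linarith
  set δ : ℝ := 1 / Real.log N with hδdef
  have hδ : 0 < δ := by positivity
  have hterm : ∀ p ∈ N.primesLE, 1 + (p : ℝ)⁻¹ ≤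
      (1 + (p : ℝ) ^ (-(1 + δ))) * Real.exp (δ * (Real.log p / p)) := by
    intro p hp
    have hp0 : (0 : ℝ) < p := by exact_mod_cast (hpr p hp).pos
    have hz : (p : ℝ) ^ (-(1 + δ)) = (p : ℝ) ^ (-δ) * (p : ℝ)⁻¹ := by
      rw [neg_add, add_comm, Real.rpow_add hp0, Real.rpow_neg_one]
    have h1 : 1 - δ * Real.log p ≤ (p : ℝ) ^ (-δ) := by
      rw [Real.rpow_def_of_pos hp0]
      have := Real.add_one_le_exp (Real.log p * -δ)
      linarith
    have hinv : (0 : ℝ) < (p : ℝ)⁻¹ := by positivity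
    have h2 : (p : ℝ)⁻¹ - δ * (Real.log p / p) ≤ (p : ℝ) ^ (-(1 + δ)) := by
      rw [hz, div_eq_mul_inv]
      nlinarith
    have hx : 0 ≤ δ * (Real.log p / p) := by
      have : 0 ≤ Real.log p := Real.log_natCast_nonneg p
      positivity
    have hz0 : 0 < (p : ℝ) ^ (-(1 + δ)) := by positivity
    calc 1 + (p : ℝ)⁻¹ ≤ (1 + (p : ℝ) ^ (-(1 + δ))) * (δ * (Real.log p / p) + 1) := by nlinarith
      _ ≤ _ := by gcongr; exact Real.add_one_le_exp _
  calc ∏ p ∈ N.primesLE, (1 + (p : ℝ)⁻¹)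
      ≤ ∏ p ∈ N.primesLE, ((1 + (p : ℝ) ^ (-(1 + δ))) * Real.exp (δ * (Real.log p / p))) :=
        Finset.prod_le_prod (fun p _ => by positivity) hterm
    _ = (∏ p ∈ N.primesLE, (1 + (p : ℝ) ^ (-(1 + δ)))) *
          Real.exp (δ * ∑ p ∈ N.primesLE, Real.log p / p) := by
        rw [Finset.prod_mul_distrib, ← Real.exp_sum, Finset.mul_sum]
    _ ≤ (1 + 1 / δ) * Real.exp 3 := by
        gcongr
        · exact prod_one_add_rpow_neg_le hδ _ hpr
        · have h := sum_log_div_primesLE_le N hN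
          have h4 : Real.log 4 = 2 * Real.log 2 := by
            rw [← Real.log_rpow (by norm_num)]; norm_num
          rw [hδdef, one_div, inv_mul_le_iff₀ hlogN0]
          linarith
    _ = _ := by rw [hδdef, one_div_one_div, mul_comm]

open Finset in
theorem exists_prod_primeFactors_one_add_inv_le :
    ∃ K : ℝ, 0 < K ∧ ∀ n : ℕ, 3 ≤ n →
      ∏ p ∈ n.primeFactors, (1 + (p : ℝ)⁻¹) ≤ K * Real.log (Real.log n) := by
  have hlog3 : 1 < Real.log 3 := by
    rw [Real.lt_log_iff_exp_lt (by norm_num)]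
    have := Real.exp_one_lt_d9
    linarith
  have hll3 : 0 < Real.log (Real.log 3) := Real.log_pos hlog3
  refine ⟨Real.exp 2 * Real.exp 3 * (1 / Real.log (Real.log 3) + 1), by positivity, ?_⟩
  intro n hn
  have hn3 : (3 : ℝ) ≤ n := by exact_mod_cast hn
  have hn0 : n ≠ 0 := by omega
  have hlogn : Real.log 3 ≤ Real.log n := Real.log_le_log (by norm_num) hn3
  have hlogn1 : 1 < Real.log n := hlog3.trans_le hlogn
  have hll : Real.log (Real.log 3) ≤ Real.log (Real.log n) :=
    Real.log_le_log (by linarith) hlogn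
  set N := ⌊Real.log n⌋₊ with hNdef
  have hN1 : 1 ≤ N := Nat.le_floor (by simpa using hlogn1.le)
  have hNle : (N : ℝ) ≤ Real.log n := Nat.floor_le (by linarith)
  rw [← Finset.prod_filter_mul_prod_filter_not _ (fun p => p ≤ N)]
  have hsmall : ∏ p ∈ n.primeFactors with p ≤ N, (1 + (p : ℝ)⁻¹) ≤
      Real.exp 3 * (1 + Real.log (Real.log n)) := by
    calc ∏ p ∈ n.primeFactors with p ≤ N, (1 + (p : ℝ)⁻¹)
        ≤ ∏ p ∈ N.primesLE, (1 + (p : ℝ)⁻¹) := by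
          refine Finset.prod_le_prod_of_subset_of_one_le (fun p hp => ?_)
            (fun _ _ => by positivity) (fun p _ _ => ?_)
          · rw [Finset.mem_filter] at hp
            exact Nat.mem_primesLE.2 ⟨hp.2, Nat.prime_of_mem_primeFactors hp.1⟩
          · have : (0 : ℝ) ≤ (p : ℝ)⁻¹ := by positivity
            linarith
      _ ≤ Real.exp 3 * (1 + Real.log N) := prod_primesLE_one_add_inv_le N hN1
      _ ≤ _ := by
          have : (0 : ℝ) < N := by exact_mod_cast hN1
          gcongr
  have hlarge : ∏ p ∈ n.primeFactors with ¬ p ≤ N, (1 + (p : ℝ)⁻¹) ≤ Real.exp 2 := by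
    set s := n.primeFactors.filter (fun p => ¬ p ≤ N) with hs
    have hcard : (s.card : ℝ) * Real.log 2 ≤ Real.log n := by
      have h1 : 2 ^ s.card ≤ n := by
        calc 2 ^ s.card ≤ ∏ p ∈ s, p := Finset.pow_card_le_prod _ _ _ fun p hp =>
              (Nat.prime_of_mem_primeFactors (Finset.mem_filter.1 hp).1).two_le
          _ ≤ n := Nat.le_of_dvd (by omega)
              ((Finset.prod_dvd_prod_of_subset _ _ _ (Finset.filter_subset _ _)).trans
                (Nat.prod_primeFactors_dvd n))
      rw [← Real.log_pow]
      exact Real.log_le_log (by positivity) (by exact_mod_cast h1)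
    have hlog2 := Real.log_two_gt_d9
    calc ∏ p ∈ s, (1 + (p : ℝ)⁻¹) ≤ ∏ p ∈ s, Real.exp ((Real.log n)⁻¹) := by
          refine Finset.prod_le_prod (fun _ _ => by positivity) fun p hp => ?_
          have hp' : N < p := not_le.1 (Finset.mem_filter.1 hp).2
          have hp2 : Real.log n < p := (Nat.floor_lt (by linarith)).1 hp'
          have h1 : (p : ℝ)⁻¹ ≤ (Real.log n)⁻¹ := inv_anti₀ (by linarith) hp2.le
          have := Real.add_one_le_exp (Real.log n)⁻¹
          linarith
      _ = Real.exp (s.card * (Real.log n)⁻¹) := by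
          rw [Finset.prod_const, ← Real.exp_nat_mul]
      _ ≤ Real.exp 2 := by
          apply Real.exp_le_exp.2
          rw [← div_eq_mul_inv, div_le_iff₀ (by linarith)]
          have : (0 : ℝ) ≤ s.card := by positivity
          nlinarith
  calc _ ≤ Real.exp 3 * (1 + Real.log (Real.log n)) * Real.exp 2 := by
        gcongr
        have : 0 < Real.log (Real.log n) := by linarith
        positivity
    _ = Real.exp 2 * Real.exp 3 * (1 + Real.log (Real.log n)) := by ring
    _ ≤ _ := by
        rw [mul_assoc _ (_ + _)]
        gcongr
        have : 1 ≤ 1 / Real.log (Real.log 3) * Real.log (Real.log n) := by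
          rw [one_div, ← div_eq_inv_mul, le_div_iff₀ hll3]; linarith
        linarith

open ArithmeticFunction in
theorem isMultiplicative_dvdId (k : ℤ) : (dvdId k).IsMultiplicative := by
  refine ⟨by simp [dvdId_apply], fun {a b} hab => ?_⟩
  have h : ((a * b : ℕ) : ℤ) ∣ k ↔ (a : ℤ) ∣ k ∧ (b : ℤ) ∣ k := by
    push_cast
    exact ⟨fun h => ⟨dvd_of_mul_right_dvd h, dvd_of_mul_left_dvd h⟩,
      fun h => (Nat.isCoprime_iff_coprime.2 hab).mul_dvd h.1 h.2⟩
  simp only [dvdId_apply, h]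
  by_cases ha : (a : ℤ) ∣ k <;> by_cases hb : (b : ℤ) ∣ k <;> simp [ha, hb]

open ArithmeticFunction in
theorem moebius_mul_apply_prime (g : ArithmeticFunction ℤ) {p : ℕ} (hp : p.Prime) :
    (moebius * g) p = g p - g 1 := by
  rw [mul_apply, Nat.sum_divisorsAntidiagonal (fun x y => moebius x * g y), hp.sum_divisors]
  simp [moebius_apply_prime hp, Nat.div_self hp.pos]
  ring

/-- The Jordan totient `J₂`, that is `|SL₂(ℤ/qℤ)| = q · J₂(q)`. -/
noncomputable def jordanTwo : ArithmeticFunction ℤ :=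
  ArithmeticFunction.moebius * (dvdId 0).pmul (dvdId 0)

theorem isMultiplicative_jordanTwo : jordanTwo.IsMultiplicative :=
  ArithmeticFunction.isMultiplicative_moebius.mul
    ((isMultiplicative_dvdId 0).pmul (isMultiplicative_dvdId 0))

theorem jordanTwo_prime {p : ℕ} (hp : p.Prime) : jordanTwo p = (p : ℤ) ^ 2 - 1 := by
  rw [jordanTwo, moebius_mul_apply_prime _ hp]
  simp [dvdId_apply, sq]

open Finset in
theorem prod_sq_div_sq_sub_one_le_two (s : Finset ℕ) (hs : ∀ k ∈ s, 2 ≤ k) :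
    ∏ k ∈ s, ((k : ℝ) ^ 2 / ((k : ℝ) ^ 2 - 1)) ≤ 2 := by
  have key : ∀ N : ℕ, 1 ≤ N →
      ∏ k ∈ Icc 2 N, ((k : ℝ) ^ 2 / ((k : ℝ) ^ 2 - 1)) = 2 * (N : ℝ) / ((N : ℝ) + 1) := by
    intro N hN
    induction N, hN using Nat.le_induction with
    | base => norm_num
    | succ k hk ih =>
      rw [Finset.prod_Icc_succ_top (by omega), ih]
      have hk0 : (0 : ℝ) < k := by exact_mod_cast hk
      push_cast
      have : ((k : ℝ) + 1) ^ 2 - 1 = k * (k + 2) := by ring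
      rw [this]
      field_simp
      ring
  obtain ⟨N, hN⟩ : ∃ N, ∀ k ∈ s, k ≤ N := ⟨s.sup id, fun k hk => Finset.le_sup (f := id) hk⟩
  have hone : ∀ k : ℕ, 2 ≤ k → 1 ≤ (k : ℝ) ^ 2 / ((k : ℝ) ^ 2 - 1) := by
    intro k hk
    have : (2 : ℝ) ≤ k := by exact_mod_cast hk
    rw [le_div_iff₀ (by nlinarith)]
    linarith
  calc _ ≤ ∏ k ∈ Icc 2 (N + 1), ((k : ℝ) ^ 2 / ((k : ℝ) ^ 2 - 1)) := by
        refine Finset.prod_le_prod_of_subset_of_one_le (fun k hk => ?_)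
          (fun k hk => zero_le_one.trans (hone k (hs k hk))) (fun k hk _ => ?_)
        · have := hN k hk
          exact Finset.mem_Icc.2 ⟨hs k hk, by omega⟩
        · exact hone k (Finset.mem_Icc.1 hk).1
    _ ≤ 2 := by
        rw [key _ (by omega), div_le_iff₀ (by positivity)]
        push_cast
        linarith

theorem sq_le_two_mul_jordanTwo {q : ℕ} (hq : Squarefree q) :
    (q : ℝ) ^ 2 ≤ 2 * (jordanTwo q : ℝ) := by
  have hprod := Nat.prod_primeFactors_of_squarefree hq
  have hpos : ∀ p ∈ q.primeFactors, (0 : ℝ) < (p : ℝ) ^ 2 - 1 := fun p hp => by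
    have : (2 : ℝ) ≤ p := by exact_mod_cast (Nat.prime_of_mem_primeFactors hp).two_le
    nlinarith
  have hJ : (jordanTwo q : ℝ) = ∏ p ∈ q.primeFactors, ((p : ℝ) ^ 2 - 1) := by
    conv_lhs => rw [← hprod]
    rw [isMultiplicative_jordanTwo.map_prod_of_subset_primeFactors _ _ Finset.Subset.rfl]
    push_cast
    refine Finset.prod_congr rfl fun p hp => ?_
    rw [jordanTwo_prime (Nat.prime_of_mem_primeFactors hp)]
    push_cast
    rfl
  have hJ0 : (0 : ℝ) < jordanTwo q := by
    rw [hJ]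
    exact Finset.prod_pos hpos
  have hq2 : (q : ℝ) ^ 2 = (∏ p ∈ q.primeFactors, ((p : ℝ) ^ 2 / ((p : ℝ) ^ 2 - 1))) *
      jordanTwo q := by
    rw [hJ, ← Finset.prod_mul_distrib]
    conv_lhs => rw [← hprod]
    push_cast
    rw [← Finset.prod_pow]
    refine Finset.prod_congr rfl fun p hp => ?_
    rw [div_mul_cancel₀ _ (hpos p hp).ne']
  rw [hq2]
  gcongr
  exact prod_sq_div_sq_sub_one_le_two _ fun p hp => (Nat.prime_of_mem_primeFactors hp).two_le

open ArithmeticFunction in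
theorem abs_moebius_mul_dvdId_le (n : ℤ) (q : ℕ) :
    |(((moebius * dvdId n) q : ℤ) : ℝ)| ≤ ∑ d ∈ q.divisors, if (d : ℤ) ∣ n then (d : ℝ) else 0 := by
  rw [mul_apply, Nat.sum_divisorsAntidiagonal' (fun x y => moebius x * dvdId n y)]
  push_cast
  refine (Finset.abs_sum_le_sum_abs _ _).trans (Finset.sum_le_sum fun d _ => ?_)
  rw [abs_mul, dvdId_apply]
  have hμ : |((moebius (q / d) : ℤ) : ℝ)| ≤ 1 := by
    exact_mod_cast abs_moebius_le_one
  split_ifs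
  · simpa using mul_le_mul_of_nonneg_right hμ (Nat.cast_nonneg d)
  · simp

/-- The singular series term in closed form, as an arithmetic function of the modulus. -/
noncomputable def singSeriesFun (n : ℤ) : ArithmeticFunction ℝ :=
  ((ArithmeticFunction.moebius : ArithmeticFunction ℝ).pmul
    ((ArithmeticFunction.moebius * dvdId n : ArithmeticFunction ℤ) : ArithmeticFunction ℝ)).pdiv
      (jordanTwo : ArithmeticFunction ℝ)

open ArithmeticFunction in
theorem singSeriesFun_apply (n : ℤ) (q : ℕ) :
    singSeriesFun n q = (moebius q : ℝ) * ((moebius * dvdId n) q : ℝ) / (jordanTwo q : ℝ) := rfl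

open ArithmeticFunction in
theorem isMultiplicative_singSeriesFun (n : ℤ) : (singSeriesFun n).IsMultiplicative :=
  (isMultiplicative_moebius.intCast.pmul
    (isMultiplicative_moebius.mul (isMultiplicative_dvdId n)).intCast).pdiv
      isMultiplicative_jordanTwo.intCast

open Finset ArithmeticFunction in
theorem abs_singSeriesFun_le {n : ℤ} (hn : n ≠ 0) (q : ℕ) :
    |singSeriesFun n q| ≤ ∑ d ∈ n.natAbs.divisors with Squarefree d,
      if d ∣ q then 2 * (d : ℝ) / (q : ℝ) ^ 2 else 0 := by
  have hnonneg : 0 ≤ ∑ d ∈ n.natAbs.divisors with Squarefree d,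
      if d ∣ q then 2 * (d : ℝ) / (q : ℝ) ^ 2 else 0 :=
    Finset.sum_nonneg fun d _ => by split_ifs <;> positivity
  by_cases hq : Squarefree q
  · have hq0 : (0 : ℝ) < q := by exact_mod_cast hq.ne_zero.bot_lt
    have hJ := sq_le_two_mul_jordanTwo hq
    have hJ0 : (0 : ℝ) < jordanTwo q := by
      have : 0 < (q : ℝ) ^ 2 := by positivity
      linarith
    have hμ : |((moebius q : ℤ) : ℝ)| ≤ 1 := by
      exact_mod_cast abs_moebius_le_one
    calc |singSeriesFun n q|
        = |((moebius q : ℤ) : ℝ)| * |(((moebius * dvdId n) q : ℤ) : ℝ)| / jordanTwo q := by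
          rw [singSeriesFun_apply, abs_div, abs_mul, abs_of_pos hJ0]
      _ ≤ 1 * (∑ d ∈ q.divisors, if (d : ℤ) ∣ n then (d : ℝ) else 0) / ((q : ℝ) ^ 2 / 2) := by
          gcongr
          · exact abs_moebius_mul_dvdId_le n q
          · linarith
      _ = ∑ d ∈ q.divisors.filter (fun d : ℕ => (d : ℤ) ∣ n), 2 * (d : ℝ) / (q : ℝ) ^ 2 := by
          rw [one_mul, Finset.sum_filter, Finset.sum_div]
          refine Finset.sum_congr rfl fun d _ => ?_
          split_ifs
          · field_simp
          · simp
      _ = _ := by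
          rw [← Finset.sum_filter]
          refine Finset.sum_congr ?_ fun _ _ => rfl
          ext d
          simp only [Finset.mem_filter, Nat.mem_divisors, Int.natCast_dvd]
          have := hq.ne_zero
          have := Int.natAbs_ne_zero.2 hn
          constructor
          · rintro ⟨⟨h1, -⟩, h2⟩
            exact ⟨⟨⟨h2, this⟩, hq.squarefree_of_dvd h1⟩, h1⟩
          · rintro ⟨⟨⟨h2, -⟩, -⟩, h1⟩
            exact ⟨⟨h1, hq.ne_zero⟩, h2⟩
  · rw [singSeriesFun_apply, moebius_eq_zero_of_not_squarefree hq]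
    simpa using hnonneg

open Finset in
theorem sum_multiples_div_sq_le {d Q : ℕ} (hd : 0 < d) (hQ : 1 ≤ Q) (N : ℕ) :
    ∑ q ∈ range N, (if Q ≤ q ∧ d ∣ q then 2 * (d : ℝ) / (q : ℝ) ^ 2 else 0) ≤ 4 / (Q : ℝ) := by
  have hd0 : (0 : ℝ) < d := by exact_mod_cast hd
  have hQ0 : (0 : ℝ) < Q := by exact_mod_cast hQ
  set k := (Q - 1) / d with hk
  have hkQ : (Q : ℝ) ≤ d * (k + 1) := by
    have h := Nat.lt_mul_div_succ (Q - 1) hd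
    rw [← hk] at h
    have : Q ≤ d * (k + 1) := by omega
    exact_mod_cast this
  have hsub : (range N).filter (fun q => Q ≤ q ∧ d ∣ q) ⊆ (Ioo k N).image (fun m => d * m) := by
    intro q hq
    obtain ⟨hqN, hQq, m, rfl⟩ := Finset.mem_filter.1 hq
    refine Finset.mem_image.2 ⟨m, Finset.mem_Ioo.2 ⟨?_, ?_⟩, rfl⟩
    · rw [hk, Nat.div_lt_iff_lt_mul hd, mul_comm]
      omega
    · exact lt_of_le_of_lt (Nat.le_mul_of_pos_left m hd) (Finset.mem_range.1 hqN)
  rw [← Finset.sum_filter]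
  calc _ ≤ ∑ q ∈ (Ioo k N).image (fun m => d * m), 2 * (d : ℝ) / (q : ℝ) ^ 2 :=
        Finset.sum_le_sum_of_subset_of_nonneg hsub fun _ _ _ => by positivity
    _ = ∑ m ∈ Ioo k N, 2 / (d : ℝ) * ((m : ℝ) ^ 2)⁻¹ := by
        rw [Finset.sum_image fun a _ b _ h => Nat.eq_of_mul_eq_mul_left hd h]
        refine Finset.sum_congr rfl fun m _ => ?_
        push_cast
        rw [mul_pow, div_eq_mul_inv, mul_inv]
        field_simp
    _ = 2 / (d : ℝ) * ∑ m ∈ Ioo k N, ((m : ℝ) ^ 2)⁻¹ := (Finset.mul_sum _ _ _).symm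
    _ ≤ 2 / (d : ℝ) * (2 / (k + 1)) := by
        gcongr
        exact sum_Ioo_inv_sq_le k N
    _ = 4 / (d * (k + 1)) := by
        field_simp
        ring
    _ ≤ 4 / (Q : ℝ) := by gcongr

open Finset in
theorem card_squarefree_divisors_le {ε : ℝ} (hε : 0 < ε) :
    ∃ K : ℝ, 0 < K ∧ ∀ n : ℕ, n ≠ 0 →
      ((n.divisors.filter Squarefree).card : ℝ) ≤ K * (n : ℝ) ^ ε := by
  set N := ⌊(2 : ℝ) ^ (1 / ε)⌋₊ with hN
  refine ⟨2 ^ (N + 1), by positivity, fun n hn => ?_⟩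
  have hcard : (n.divisors.filter Squarefree).card = 2 ^ n.primeFactors.card := by
    rw [Finset.card_eq_sum_ones, Nat.sum_divisors_filter_squarefree hn, Finset.sum_const,
      smul_eq_mul, mul_one, Finset.card_powerset, Nat.factors_eq]
    rfl
  have hterm : ∀ p ∈ n.primeFactors, (2 : ℝ) ≤ (if p ≤ N then 2 else 1) * (p : ℝ) ^ ε := by
    intro p hp
    have hp1 : (1 : ℝ) ≤ p := by exact_mod_cast (Nat.prime_of_mem_primeFactors hp).one_le
    split_ifs with h
    · have := Real.one_le_rpow hp1 hε.le
      linarith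
    · have h2 : (2 : ℝ) ^ (1 / ε) ≤ p := ((Nat.floor_lt (by positivity)).1 (not_le.1 h)).le
      calc (2 : ℝ) = ((2 : ℝ) ^ (1 / ε)) ^ ε := by
            rw [← Real.rpow_mul (by norm_num), one_div_mul_cancel hε.ne', Real.rpow_one]
        _ ≤ (p : ℝ) ^ ε := by gcongr
        _ = _ := (one_mul _).symm
  have hsmall : ∏ p ∈ n.primeFactors, (if p ≤ N then (2 : ℝ) else 1) ≤ 2 ^ (N + 1) := by
    rw [Finset.prod_ite, Finset.prod_const, Finset.prod_const_one, mul_one]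
    refine pow_le_pow_right₀ (by norm_num) ?_
    rw [← Finset.card_range (N + 1)]
    refine Finset.card_le_card fun p hp => ?_
    have := (Finset.mem_filter.1 hp).2
    exact Finset.mem_range.2 (by omega)
  have hlarge : ∏ p ∈ n.primeFactors, (p : ℝ) ^ ε ≤ (n : ℝ) ^ ε := by
    rw [Real.finsetProd_rpow _ _ (fun p _ => Nat.cast_nonneg p)]
    gcongr
    rw [← Nat.cast_prod]
    exact_mod_cast Nat.le_of_dvd (Nat.pos_of_ne_zero hn) (Nat.prod_primeFactors_dvd n)
  rw [hcard]
  push_cast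
  calc (2 : ℝ) ^ n.primeFactors.card = ∏ p ∈ n.primeFactors, (2 : ℝ) := by
        rw [Finset.prod_const]
    _ ≤ ∏ p ∈ n.primeFactors, ((if p ≤ N then 2 else 1) * (p : ℝ) ^ ε) :=
        Finset.prod_le_prod (fun _ _ => by norm_num) hterm
    _ = (∏ p ∈ n.primeFactors, (if p ≤ N then (2 : ℝ) else 1)) *
          ∏ p ∈ n.primeFactors, (p : ℝ) ^ ε := Finset.prod_mul_distrib
    _ ≤ _ := by gcongr

open Finset in
theorem sum_range_abs_singSeriesFun_le {n : ℤ} (hn : n ≠ 0) {Q : ℕ} (hQ : 1 ≤ Q) (N : ℕ) :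
    ∑ q ∈ range N, (if Q ≤ q then |singSeriesFun n q| else 0) ≤
      ((n.natAbs.divisors.filter Squarefree).card : ℝ) * (4 / (Q : ℝ)) := by
  calc ∑ q ∈ range N, (if Q ≤ q then |singSeriesFun n q| else 0)
      ≤ ∑ q ∈ range N, ∑ d ∈ n.natAbs.divisors with Squarefree d,
          if Q ≤ q ∧ d ∣ q then 2 * (d : ℝ) / (q : ℝ) ^ 2 else 0 := by
        refine Finset.sum_le_sum fun q _ => ?_
        by_cases h : Q ≤ q
        · simpa [h] using abs_singSeriesFun_le hn q
        · simp [h]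
    _ = ∑ d ∈ n.natAbs.divisors with Squarefree d, ∑ q ∈ range N,
          if Q ≤ q ∧ d ∣ q then 2 * (d : ℝ) / (q : ℝ) ^ 2 else 0 := Finset.sum_comm
    _ ≤ ∑ d ∈ n.natAbs.divisors with Squarefree d, 4 / (Q : ℝ) := by
        refine Finset.sum_le_sum fun d hd => sum_multiples_div_sq_le ?_ hQ N
        exact Nat.pos_of_mem_divisors (Finset.mem_filter.1 hd).1
    _ = _ := by rw [Finset.sum_const, nsmul_eq_mul]

theorem summable_abs_singSeriesFun {n : ℤ} (hn : n ≠ 0) :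
    Summable (fun q : ℕ => |singSeriesFun n q|) := by
  refine summable_of_sum_range_le
    (c := ((n.natAbs.divisors.filter Squarefree).card : ℝ) * (4 / ((1 : ℕ) : ℝ)))
    (fun _ => abs_nonneg _) fun N => ?_
  refine le_trans (Finset.sum_le_sum fun q _ => ?_) (sum_range_abs_singSeriesFun_le hn le_rfl N)
  rcases Nat.eq_zero_or_pos q with rfl | hq
  · simp
  · rw [if_pos (Nat.one_le_iff_ne_zero.2 hq.ne')]

open ArithmeticFunction in
theorem tsum_singSeriesFun_prime_pow (n : ℤ) {p : ℕ} (hp : p.Prime) :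
    ∑' e : ℕ, singSeriesFun n (p ^ e) =
      if (p : ℤ) ∣ n then (1 + (p : ℝ)⁻¹)⁻¹ else (p : ℝ) ^ 2 / ((p : ℝ) ^ 2 - 1) := by
  rw [tsum_eq_sum (s := Finset.range 2)]
  · have hp2 : (2 : ℝ) ≤ p := by exact_mod_cast hp.two_le
    have h1 : (p : ℝ) ^ 2 - 1 ≠ 0 := by nlinarith
    have hone : dvdId n 1 = 1 := by simp [dvdId_apply]
    rw [Finset.sum_range_succ, Finset.sum_range_one, pow_zero, pow_one,
      (isMultiplicative_singSeriesFun n).map_one, singSeriesFun_apply, moebius_apply_prime hp,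
      moebius_mul_apply_prime _ hp, jordanTwo_prime hp, hone, dvdId_apply]
    split_ifs with h
    · push_cast
      have h2 : (p : ℝ) + 1 ≠ 0 := by positivity
      have h3 : (p : ℝ) ≠ 0 := by positivity
      have h4 : (p : ℝ) ^ 2 - 1 = (p - 1) * (p + 1) := by ring
      have h5 : (p : ℝ) - 1 ≠ 0 := by linarith
      rw [h4]
      field_simp
      ring
    · push_cast
      field_simp
      ring
  · intro e he
    have he2 : 2 ≤ e := by
      have := Finset.mem_range.not.1 he
      omega
    rw [singSeriesFun_apply, moebius_eq_zero_of_not_squarefree]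
    · simp
    · intro hsq
      have := (Nat.squarefree_iff_prime_squarefree.1 hsq) p hp
      exact this (by rw [← sq]; exact pow_dvd_pow p he2)

theorem tsum_singSeriesFun_le_two {n : ℤ} (hn : n ≠ 0) : ∑' q, singSeriesFun n q ≤ 2 := by
  have hlim := (isMultiplicative_singSeriesFun n).eulerProduct
    (by simpa using summable_abs_singSeriesFun hn)
  refine le_of_tendsto' hlim fun N => ?_
  refine le_trans (Finset.prod_le_prod (fun p hp => ?_) fun p hp => ?_)
    (prod_sq_div_sq_sub_one_le_two N.primesBelow fun p hp =>
      (Nat.prime_of_mem_primesBelow hp).two_le)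
  all_goals
    have hp' := Nat.prime_of_mem_primesBelow hp
    have hp2 : (2 : ℝ) ≤ p := by exact_mod_cast hp'.two_le
    have h1 : (0 : ℝ) < (p : ℝ) ^ 2 - 1 := by nlinarith
    rw [tsum_singSeriesFun_prime_pow n hp']
  · split_ifs <;> positivity
  · split_ifs
    · have h2 : (1 + (p : ℝ)⁻¹)⁻¹ ≤ 1 := inv_le_one_of_one_le₀ (by
        have : (0 : ℝ) < (p : ℝ)⁻¹ := by positivity
        linarith)
      refine h2.trans ?_
      rw [le_div_iff₀ h1]
      linarith
    · rfl

theorem le_tsum_singSeriesFun {n : ℤ} (hn : n ≠ 0) :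
    (∏ p ∈ n.natAbs.primeFactors, (1 + (p : ℝ)⁻¹))⁻¹ ≤ ∑' q, singSeriesFun n q := by
  have hlim := (isMultiplicative_singSeriesFun n).eulerProduct
    (by simpa using summable_abs_singSeriesFun hn)
  refine ge_of_tendsto' hlim fun N => ?_
  have hone : ∀ p : ℕ, 1 ≤ 1 + (p : ℝ)⁻¹ := fun p => by
    have : (0 : ℝ) ≤ (p : ℝ)⁻¹ := by positivity
    linarith
  calc (∏ p ∈ n.natAbs.primeFactors, (1 + (p : ℝ)⁻¹))⁻¹
      ≤ (∏ p ∈ N.primesBelow.filter (fun p : ℕ => (p : ℤ) ∣ n), (1 + (p : ℝ)⁻¹))⁻¹ := by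
        refine inv_anti₀ (Finset.prod_pos fun p _ => by positivity) ?_
        refine Finset.prod_le_prod_of_subset_of_one_le (fun p hp => ?_)
          (fun _ _ => by positivity) fun p _ _ => hone p
        obtain ⟨hpN, hpn⟩ := Finset.mem_filter.1 hp
        exact Nat.mem_primeFactors.2 ⟨Nat.prime_of_mem_primesBelow hpN, Int.natCast_dvd.1 hpn,
          Int.natAbs_ne_zero.2 hn⟩
    _ = ∏ p ∈ N.primesBelow, if (p : ℤ) ∣ n then (1 + (p : ℝ)⁻¹)⁻¹ else 1 := by
        rw [← Finset.prod_inv_distrib, Finset.prod_filter]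
    _ ≤ _ := by
        refine Finset.prod_le_prod (fun p _ => by split_ifs <;> positivity) fun p hp => ?_
        have hp' := Nat.prime_of_mem_primesBelow hp
        have hp2 : (2 : ℝ) ≤ p := by exact_mod_cast hp'.two_le
        rw [tsum_singSeriesFun_prime_pow n hp']
        split_ifs
        · rfl
        · rw [le_div_iff₀ (by nlinarith)]
          linarith

/-- For the bilinear case `Δ = AD − BC = 0` (with `gcd(A,B,C,D) = 1`): the singular series
`𝔖(n) = Σ_q 𝔖_q(n)` converges absolutely with tail bound `O_ε(|n|^ε / Q)`, and for `|n| ≥ 3`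
it satisfies `1/log log |n| ≪ 𝔖(n) ≪ 1`. -/
theorem singSeries_bilinear_case (A B C D : ℤ)
    (hgcd : Int.gcd A (Int.gcd B (Int.gcd C D)) = 1) (hΔ : A * D - B * C = 0) :
    (∀ ε : ℝ, 0 < ε → ∃ K : ℝ, 0 < K ∧ ∀ n : ℤ, n ≠ 0 →
      Summable (fun q : ℕ => |singSeriesTerm A B C D q n|) ∧
      ∀ Q : ℕ, 1 ≤ Q →
        (∑' q : ℕ, if Q ≤ q then |singSeriesTerm A B C D q n| else 0)
          ≤ K * ((|n| : ℤ) : ℝ) ^ ε / Q) ∧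
    (∃ c₀ K₀ : ℝ, 0 < c₀ ∧ 0 < K₀ ∧ ∀ n : ℤ, 3 ≤ |n| →
      c₀ / Real.log (Real.log ((|n| : ℤ) : ℝ)) ≤ (∑' q : ℕ, singSeriesTerm A B C D q n) ∧
      (∑' q : ℕ, singSeriesTerm A B C D q n) ≤ K₀) := by
  have hfun : ∀ q n, singSeriesTerm A B C D q n = singSeriesFun n q :=
    fun q n => singSeriesTerm_eq hgcd hΔ q n
  simp_rw [hfun]
  have habs : ∀ n : ℤ, ((|n| : ℤ) : ℝ) = (n.natAbs : ℝ) := fun n => by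
    rw [← Int.natCast_natAbs, Int.cast_natCast]
  refine ⟨fun ε hε => ?_, ?_⟩
  · obtain ⟨K, hK, hcard⟩ := card_squarefree_divisors_le hε
    refine ⟨4 * K, by positivity, fun n hn => ⟨summable_abs_singSeriesFun hn, fun Q hQ => ?_⟩⟩
    refine Real.tsum_le_of_sum_range_le (fun q => by split_ifs <;> positivity) fun N => ?_
    refine (sum_range_abs_singSeriesFun_le hn hQ N).trans ?_
    have h := hcard n.natAbs (Int.natAbs_ne_zero.2 hn)
    rw [habs]
    calc _ ≤ K * (n.natAbs : ℝ) ^ ε * (4 / Q) := by gcongr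
      _ = _ := by ring
  · obtain ⟨K, hK, hprod⟩ := exists_prod_primeFactors_one_add_inv_le
    refine ⟨K⁻¹, 2, by positivity, by norm_num, fun n hn => ?_⟩
    have hn0 : n ≠ 0 := by
      rintro rfl
      simp at hn
    refine ⟨le_trans ?_ (le_tsum_singSeriesFun hn0), tsum_singSeriesFun_le_two hn0⟩
    have h3 : 3 ≤ n.natAbs := by
      zify
      exact hn
    have h := hprod n.natAbs h3
    rw [habs, div_eq_mul_inv, ← mul_inv]
    exact inv_anti₀ (Finset.prod_pos fun p _ => by positivity) h
end
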